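/- arXiv:2301.12115 — 6 statements merged into one kernel-verified Lean document; each statement's English description precedes it below -/
import Mathlib

section
/- Let x > 1 and let u : ℝ → ℝ² be continuous on [0, x − 1]. Then ∫₀^{x−1} ⟨v(y), Q(y + 1) • u(x − 1 − y)⟩ dy = ∫₀^{x−1} ⟨v(−1), u(y)⟩ dy. -/
open Real MeasureTheory
open scoped RealInnerProductSpace

noncomputable def Q (y : ℝ) : Matrix (Fin 2) (Fin 2) ℝ :=
  !![Real.cos (Real.pi * y / 3), -Real.sin (Real.pi * y / 3);
     Real.sin (Real.pi * y / 3),  Real.cos (Real.pi * y / 3)]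

/-- The action of a 2×2 matrix on a vector in Euclidean space `ℝ²`. -/
noncomputable def act (A : Matrix (Fin 2) (Fin 2) ℝ) (w : EuclideanSpace ℝ (Fin 2)) :
    EuclideanSpace ℝ (Fin 2) :=
  (WithLp.equiv 2 (Fin 2 → ℝ)).symm (A.mulVec ((WithLp.equiv 2 (Fin 2 → ℝ)) w))

noncomputable def v (y : ℝ) : EuclideanSpace ℝ (Fin 2) :=
  (WithLp.equiv 2 (Fin 2 → ℝ)).symm ![Real.cos (Real.pi * y / 3), Real.sin (Real.pi * y / 3)]

theorem integral_inner_v_Q (x : ℝ) (hx : 1 < x) (u : ℝ → EuclideanSpace ℝ (Fin 2))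
    (hu : ContinuousOn u (Set.Icc 0 (x - 1))) :
    ∫ y in (0 : ℝ)..(x - 1), ⟪v y, act (Q (y + 1)) (u (x - 1 - y))⟫ =
      ∫ y in (0 : ℝ)..(x - 1), ⟪v (-1), u y⟫ := by
  have key : ∀ (y : ℝ) (w : EuclideanSpace ℝ (Fin 2)),
      ⟪v y, act (Q (y + 1)) w⟫ = ⟪v (-1), w⟫ := by
    intro y w
    have e : Real.pi * (-1) / 3 = Real.pi * y / 3 - Real.pi * (y + 1) / 3 := by ring
    simp only [v, act, Q, e, Real.cos_sub, Real.sin_sub]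
    simp [PiLp.inner_apply, Fin.sum_univ_two, Matrix.mulVec, dotProduct]
    ring
  simp only [key]
  have h := intervalIntegral.integral_comp_sub_left (a := 0) (b := x - 1)
    (fun y => ⟪v (-1), u y⟫) (x - 1)
  simpa using h
end

section
/- Let g : ℝ → ℝ and suppose u₁, u₂ : ℝ → ℝ are locally integrable functions that both vanish on [0, 1) and both satisfy u(x) = (2/(x − 1)) ∫₀^{x−1} u(y) dy + g(x) for all x > 1. Then u₁(x) = u₂(x) for all x > 1. -/
open Real MeasureTheory
open scoped RealInnerProductSpace

theorem renyi_uniqueness (g : ℝ → ℝ) (u₁ u₂ : ℝ → ℝ)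
    (hloc₁ : LocallyIntegrable u₁ volume) (hloc₂ : LocallyIntegrable u₂ volume)
    (h0₁ : ∀ x ∈ Set.Ico (0 : ℝ) 1, u₁ x = 0)
    (h0₂ : ∀ x ∈ Set.Ico (0 : ℝ) 1, u₂ x = 0)
    (heq₁ : ∀ x > (1 : ℝ),
      u₁ x = (2 / (x - 1)) * (∫ y in Set.Icc (0 : ℝ) (x - 1), u₁ y) + g x)
    (heq₂ : ∀ x > (1 : ℝ),
      u₂ x = (2 / (x - 1)) * (∫ y in Set.Icc (0 : ℝ) (x - 1), u₂ y) + g x) :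
    ∀ x > (1 : ℝ), u₁ x = u₂ x := by
  have key : ∀ n : ℕ, ∀ x > (1 : ℝ), x ≤ (n : ℝ) + 1 → u₁ x = u₂ x := by
    intro n
    induction n with
    | zero =>
      intro x hx hxn
      simp at hxn
      linarith
    | succ n ih =>
      intro x hx hxn
      push_cast at hxn
      have hI : (∫ y in Set.Icc (0 : ℝ) (x - 1), u₁ y)
          = ∫ y in Set.Icc (0 : ℝ) (x - 1), u₂ y := by
        apply setIntegral_congr_ae measurableSet_Icc
        have h1 : ∀ᵐ y : ℝ ∂volume, y ≠ 1 := by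
          simp [ae_iff]
        filter_upwards [h1] with y hy hmem
        rcases lt_or_gt_of_ne hy with h | h
        · rw [h0₁ y ⟨hmem.1, h⟩, h0₂ y ⟨hmem.1, h⟩]
        · exact ih y h (by linarith [hmem.2])
      rw [heq₁ x hx, heq₂ x hx, hI]
  intro x hx
  obtain ⟨n, hn⟩ := exists_nat_ge x
  exact key n x hx (by linarith)
end

section
/- Let g : ℝ → ℝ² and suppose u₁, u₂ : ℝ → ℝ² are locally integrable functions that both vanish on [0, 1) and both satisfy u(x) = (1/(x − 1)) ∫₀^{x−1} (u(y) + Q(x − y) • u(y)) dy + g(x) for all x > 1. Then u₁(x) = u₂(x) for all x > 1. -/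
open Real MeasureTheory
open scoped RealInnerProductSpace

theorem renyi_uniqueness_vector (g : ℝ → EuclideanSpace ℝ (Fin 2))
    (u₁ u₂ : ℝ → EuclideanSpace ℝ (Fin 2))
    (hloc₁ : LocallyIntegrable u₁ volume) (hloc₂ : LocallyIntegrable u₂ volume)
    (h0₁ : ∀ x ∈ Set.Ico (0 : ℝ) 1, u₁ x = 0)
    (h0₂ : ∀ x ∈ Set.Ico (0 : ℝ) 1, u₂ x = 0)
    (heq₁ : ∀ x > (1 : ℝ),
      u₁ x = (1 / (x - 1)) •
        (∫ y in Set.Icc (0 : ℝ) (x - 1), (u₁ y + act (Q (x - y)) (u₁ y))) + g x)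
    (heq₂ : ∀ x > (1 : ℝ),
      u₂ x = (1 / (x - 1)) •
        (∫ y in Set.Icc (0 : ℝ) (x - 1), (u₂ y + act (Q (x - y)) (u₂ y))) + g x) :
    ∀ x > (1 : ℝ), u₁ x = u₂ x := by
  have key : ∀ n : ℕ, ∀ x : ℝ, 1 < x → x < n → u₁ x = u₂ x := by
    intro n
    induction n with
    | zero =>
      intro x h1 h2
      simp at h2
      linarith
    | succ n ih =>
      intro x h1 h2
      push_cast at h2
      rw [heq₁ x h1, heq₂ x h1]
      have hint : (∫ y in Set.Icc (0 : ℝ) (x - 1), (u₁ y + act (Q (x - y)) (u₁ y))) =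
          ∫ y in Set.Icc (0 : ℝ) (x - 1), (u₂ y + act (Q (x - y)) (u₂ y)) := by
        apply setIntegral_congr_ae measurableSet_Icc
        have hne : ∀ᵐ y : ℝ ∂volume, y ≠ 1 := Measure.ae_ne volume 1
        filter_upwards [hne] with y hy hm
        have hu : u₁ y = u₂ y := by
          rcases lt_or_gt_of_ne hy with h | h
          · rw [h0₁ y ⟨hm.1, h⟩, h0₂ y ⟨hm.1, h⟩]
          · exact ih y h (by linarith [hm.2])
        rw [hu]
      rw [hint]
  intro x hx
  obtain ⟨n, hn⟩ := exists_nat_gt x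
  exact key n x hx hn
end

section
/- Let g : ℝ → ℝ be continuous on [1, ∞). Then there exists a function u : ℝ → ℝ with u(x) = 0 for all x ∈ [0, 1), u continuous on [1, ∞), and u(x) = (2/(x − 1)) ∫₀^{x−1} u(y) dy + g(x) for all x > 1, with u(1) = g(1). -/
open Real MeasureTheory
open scoped RealInnerProductSpace

noncomputable def renyiS (g : ℝ → ℝ) (w : ℝ → ℝ) (x : ℝ) : ℝ :=
  2 / max (x - 1) 1 * (∫ y in (1 : ℝ)..max (x - 1) 1, w y) + g (max x 1)

noncomputable def renyiU (g : ℝ → ℝ) : ℕ → ℝ → ℝ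
  | 0 => fun _ => 0
  | n + 1 => renyiS g (renyiU g n)

lemma renyiS_cont {g : ℝ → ℝ} (hg : ContinuousOn g (Set.Ici (1 : ℝ))) {w : ℝ → ℝ}
    (hw : Continuous w) : Continuous (renyiS g w) := by
  have h1 : Continuous fun x : ℝ => max (x - 1) 1 := by fun_prop
  have h2 : Continuous fun t : ℝ => ∫ y in (1 : ℝ)..t, w y :=
    intervalIntegral.continuous_primitive (fun a b => hw.intervalIntegrable a b) 1
  have h3 : Continuous fun x : ℝ => g (max x 1) :=
    hg.comp_continuous (by fun_prop) (fun x => Set.mem_Ici.2 (le_max_right _ _))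
  unfold renyiS
  refine Continuous.add (Continuous.mul (continuous_const.div h1 ?_) (h2.comp h1)) h3
  intro x
  have := le_max_right (x - 1) 1
  positivity

lemma renyiU_cont {g : ℝ → ℝ} (hg : ContinuousOn g (Set.Ici (1 : ℝ))) (n : ℕ) :
    Continuous (renyiU g n) := by
  induction n with
  | zero => exact continuous_const
  | succ n ih => exact renyiS_cont hg ih

lemma renyiS_congr (g : ℝ → ℝ) {w w' : ℝ → ℝ} {x : ℝ}
    (h : ∀ y, 1 ≤ y → y ≤ x - 1 → w y = w' y) : renyiS g w x = renyiS g w' x := by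
  unfold renyiS
  congr 2
  rcases le_total (x - 1) 1 with h1 | h1
  · simp [max_eq_right h1]
  · rw [max_eq_left h1]
    apply intervalIntegral.integral_congr
    intro y hy
    rw [Set.uIcc_of_le h1] at hy
    exact h y hy.1 hy.2

lemma renyiU_succ_eq (g : ℝ → ℝ) (n : ℕ) : ∀ x : ℝ, 1 ≤ x → x < n →
    renyiU g (n + 1) x = renyiU g n x := by
  induction n with
  | zero => intro x h1 h2; simp at h2; linarith
  | succ n ih =>
    intro x h1 h2
    push_cast at h2
    exact renyiS_congr g (fun y hy hy' => ih y hy (by linarith))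

lemma renyiU_eq (g : ℝ → ℝ) {n m : ℕ} (hnm : n ≤ m) {x : ℝ} (h1 : 1 ≤ x) (h2 : x < n) :
    renyiU g m x = renyiU g n x := by
  induction m, hnm using Nat.le_induction with
  | base => rfl
  | succ m hm ih =>
    rw [renyiU_succ_eq g m x h1 (h2.trans_le (by exact_mod_cast hm)), ih]

theorem renyi_existence (g : ℝ → ℝ) (hg : ContinuousOn g (Set.Ici (1 : ℝ))) :
    ∃ u : ℝ → ℝ,
      (∀ x ∈ Set.Ico (0 : ℝ) 1, u x = 0) ∧
      ContinuousOn u (Set.Ici (1 : ℝ)) ∧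
      (∀ x > (1 : ℝ),
        u x = (2 / (x - 1)) * (∫ y in Set.Icc (0 : ℝ) (x - 1), u y) + g x) ∧
      u 1 = g 1 := by
  set u : ℝ → ℝ := fun x => if x < 1 then 0 else renyiU g (⌊x⌋₊ + 1) x with hu
  have hu0 : ∀ x < 1, u x = 0 := fun x hx => by simp [hu, hx]
  have hun : ∀ (n : ℕ) (x : ℝ), 1 ≤ x → x < n → u x = renyiU g n x := by
    intro n x h1 h2
    have : ⌊x⌋₊ < n := (Nat.floor_lt (by linarith)).2 h2
    simp only [hu, not_lt.2 h1, if_false]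
    exact (renyiU_eq g this h1 (by exact_mod_cast Nat.lt_floor_add_one x)).symm
  have hfix : ∀ x, 1 ≤ x → u x = renyiS g u x := by
    intro x h1
    obtain ⟨n, hn⟩ := exists_nat_gt x
    rw [hun (n + 1) x h1 (by push_cast; linarith)]
    exact renyiS_congr g (fun y hy hy' => (hun n y hy (by linarith)).symm)
  have hint : ∀ x : ℝ, (∫ y in Set.Icc (0 : ℝ) (x - 1), u y)
      = ∫ y in (1 : ℝ)..max (x - 1) 1, u y := by
    intro x
    have hind : u = Set.indicator (Set.Ici 1) u := by
      ext y
      by_cases hy : y < 1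
      · rw [hu0 y hy]; simp [hy]
      · simp [Set.indicator, not_lt.1 hy]
    conv_lhs => rw [hind]
    rw [setIntegral_indicator measurableSet_Ici]
    have hs : Set.Icc (0 : ℝ) (x - 1) ∩ Set.Ici 1 = Set.Icc 1 (x - 1) := by
      ext y
      simp only [Set.mem_inter_iff, Set.mem_Icc, Set.mem_Ici]
      constructor
      · rintro ⟨⟨_, h⟩, h'⟩; exact ⟨h', h⟩
      · rintro ⟨h, h'⟩; exact ⟨⟨by linarith, h'⟩, h⟩
    rw [hs, integral_Icc_eq_integral_Ioc, intervalIntegral.integral_of_le (le_max_right _ _)]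
    rcases le_total (x - 1) 1 with h1 | h1
    · simp [h1]
    · rw [max_eq_left h1]
  refine ⟨u, fun x hx => hu0 x hx.2, ?_, ?_, ?_⟩
  · intro x hx
    obtain ⟨n, hn⟩ := exists_nat_gt x
    refine (renyiU_cont hg n).continuousWithinAt.congr_of_eventuallyEq ?_ (hun n x hx hn)
    filter_upwards [self_mem_nhdsWithin, mem_nhdsWithin_of_mem_nhds (Iio_mem_nhds hn)] with y hy hy'
    exact hun n y hy hy'
  · intro x hx
    rw [hfix x hx.le, hint x, renyiS, max_eq_left hx.le]
    congr 1
    rcases le_total (x - 1) 1 with h1 | h1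
    · simp [max_eq_right h1]
    · rw [max_eq_left h1]
  · rw [hfix 1 le_rfl, renyiS]
    simp
end

section
/- Let g : ℝ → ℝ be continuous on [1, ∞), and let u : ℝ → ℝ be locally integrable with u(x) = 0 for x ∈ [0, 1), u(1) = g(1), and u(x) = (2/(x − 1)) ∫₀^{x−1} u(y) dy + g(x) for all x > 1. Then u is continuous on [1, ∞). -/
open Real MeasureTheory
open scoped RealInnerProductSpace

theorem renyi_continuity (g : ℝ → ℝ) (hg : ContinuousOn g (Set.Ici (1 : ℝ)))
    (u : ℝ → ℝ) (hloc : LocallyIntegrable u volume)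
    (h0 : ∀ x ∈ Set.Ico (0 : ℝ) 1, u x = 0)
    (h1 : u 1 = g 1)
    (heq : ∀ x > (1 : ℝ),
      u x = (2 / (x - 1)) * (∫ y in Set.Icc (0 : ℝ) (x - 1), u y) + g x) :
    ContinuousOn u (Set.Ici (1 : ℝ)) := by
  have hF : Continuous (fun b : ℝ => ∫ y in (0 : ℝ)..b, u y) :=
    intervalIntegral.continuous_primitive (fun a b => (hloc.integrableOn_isCompact isCompact_uIcc).intervalIntegrable) 0
  have hI : ∀ x > (1 : ℝ), u x = (2 / (x - 1)) * (∫ y in (0 : ℝ)..(x - 1), u y) + g x := by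
    intro x hx
    rw [heq x hx, integral_Icc_eq_integral_Ioc,
      intervalIntegral.integral_of_le (by linarith : (0 : ℝ) ≤ x - 1)]
  have hsmall : ∀ x ∈ Set.Ico (1 : ℝ) 2, u x = g x := by
    intro x hx
    rcases eq_or_lt_of_le hx.1 with h | h
    · rw [← h, h1]
    · rw [heq x h, setIntegral_eq_zero_of_forall_eq_zero]
      · simp
      · intro y hy
        exact h0 y ⟨hy.1, by linarith [hy.2, hx.2]⟩
  intro x hx
  rcases eq_or_lt_of_le (show (1 : ℝ) ≤ x from hx) with h | h
  · refine (hg x hx).congr_of_eventuallyEq ?_ (hsmall x ⟨hx, by linarith⟩)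
    have h2 : ∀ᶠ y in nhdsWithin x (Set.Ici 1), y < 2 :=
      nhdsWithin_le_nhds (eventually_lt_nhds (by linarith))
    filter_upwards [h2, self_mem_nhdsWithin] with y hy hy1
    exact hsmall y ⟨hy1, hy⟩
  · have hc : ContinuousWithinAt
        (fun x => (2 / (x - 1)) * (∫ y in (0 : ℝ)..(x - 1), u y) + g x) (Set.Ici 1) x := by
      refine ContinuousWithinAt.add (ContinuousAt.continuousWithinAt ?_) (hg x hx)
      refine ContinuousAt.mul ?_ ?_
      · exact continuousAt_const.div (by fun_prop) (sub_ne_zero.mpr h.ne.symm)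
      · exact (hF.comp (continuous_id.sub continuous_const)).continuousAt
    refine hc.congr_of_eventuallyEq ?_ (hI x h)
    have h2 : ∀ᶠ y in nhdsWithin x (Set.Ici 1), 1 < y :=
      nhdsWithin_le_nhds (eventually_gt_nhds h)
    filter_upwards [h2] with y hy
    exact hI y hy
end

section
/- Let g : ℝ → ℝ be infinitely differentiable on the open interval (j, j+1) for every integer j ≥ 1, and let u : ℝ → ℝ be locally integrable with u(x) = 0 for x ∈ [0, 1) and u(x) = (2/(x − 1)) ∫₀^{x−1} u(y) dy + g(x) for all x > 1. Then u is infinitely differentiable on the open interval (k, k+1) for every integer k ≥ 1. -/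
open Real MeasureTheory
open scoped RealInnerProductSpace

theorem renyi_prim (u : ℝ → ℝ) (hloc : LocallyIntegrable u volume) (a b : ℝ)
    (hu : ContDiffOn ℝ (⊤ : ℕ∞) u (Set.Ioo a b)) :
    ContDiffOn ℝ (⊤ : ℕ∞) (fun x => ∫ y in (0 : ℝ)..x, u y) (Set.Ioo a b) := by
  have hd : ∀ x ∈ Set.Ioo a b, HasDerivAt (fun x => ∫ y in (0 : ℝ)..x, u y) (u x) x := by
    intro x hx
    apply intervalIntegral.integral_hasDerivAt_right
    · exact (hloc.integrableOn_isCompact isCompact_uIcc).intervalIntegrable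
    · exact hu.continuousOn.stronglyMeasurableAtFilter isOpen_Ioo x hx
    · exact hu.continuousOn.continuousAt (isOpen_Ioo.mem_nhds hx)
  rw [contDiffOn_infty_iff_deriv_of_isOpen isOpen_Ioo]
  exact ⟨fun x hx => (hd x hx).differentiableAt.differentiableWithinAt,
    hu.congr fun x hx => (hd x hx).deriv⟩

theorem renyi_step (g u : ℝ → ℝ) (hloc : LocallyIntegrable u volume)
    (heq : ∀ x > (1 : ℝ),
      u x = (2 / (x - 1)) * (∫ y in Set.Icc (0 : ℝ) (x - 1), u y) + g x) (a b : ℝ) (ha : 0 ≤ a)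
    (hg : ContDiffOn ℝ (⊤ : ℕ∞) g (Set.Ioo (a + 1) (b + 1)))
    (hu : ContDiffOn ℝ (⊤ : ℕ∞) u (Set.Ioo a b)) :
    ContDiffOn ℝ (⊤ : ℕ∞) u (Set.Ioo (a + 1) (b + 1)) := by
  have hF := renyi_prim u hloc a b hu
  have hs : ContDiffOn ℝ (⊤ : ℕ∞) (fun x : ℝ => x - 1) (Set.Ioo (a + 1) (b + 1)) :=
    (contDiff_id.sub contDiff_const).contDiffOn
  have hc := hF.comp hs (fun x hx => ⟨by linarith [hx.1], by linarith [hx.2]⟩)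
  have hq : ContDiffOn ℝ (⊤ : ℕ∞) (fun x : ℝ => 2 / (x - 1)) (Set.Ioo (a + 1) (b + 1)) :=
    contDiffOn_const.div hs (fun x hx => by have := hx.1; intro h; linarith)
  refine ((hq.mul hc).add hg).congr fun x hx => ?_
  have h1 := hx.1
  rw [heq x (by linarith), integral_Icc_eq_integral_Ioc,
    ← intervalIntegral.integral_of_le (by linarith)]
  rfl

theorem renyi_smoothness (g : ℝ → ℝ)
    (hg : ∀ j : ℤ, 1 ≤ j → ContDiffOn ℝ (⊤ : ℕ∞) g (Set.Ioo (j : ℝ) ((j : ℝ) + 1)))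
    (u : ℝ → ℝ) (hloc : LocallyIntegrable u volume)
    (h0 : ∀ x ∈ Set.Ico (0 : ℝ) 1, u x = 0)
    (heq : ∀ x > (1 : ℝ),
      u x = (2 / (x - 1)) * (∫ y in Set.Icc (0 : ℝ) (x - 1), u y) + g x) :
    ∀ k : ℤ, 1 ≤ k → ContDiffOn ℝ (⊤ : ℕ∞) u (Set.Ioo (k : ℝ) ((k : ℝ) + 1)) := by
  have key : ∀ n : ℕ, ContDiffOn ℝ (⊤ : ℕ∞) u (Set.Ioo (n : ℝ) ((n : ℝ) + 1)) := by
    intro n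
    induction n with
    | zero =>
      refine (contDiffOn_const (c := (0 : ℝ))).congr fun x hx => h0 x ⟨?_, ?_⟩
      · simpa using hx.1.le
      · simpa using hx.2
    | succ n ih =>
      have h := hg (n + 1) (by omega)
      push_cast at h ⊢
      exact renyi_step g u hloc heq n (n + 1) n.cast_nonneg h ih
  intro k hk
  lift k to ℕ using by omega
  simpa using key k
end
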